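/- arXiv:1405.5011 — 8 statements merged into one kernel-verified Lean document; each statement's English description precedes it below -/
import Mathlib

section
/- Let 0 < α < 1 and let λ > 0 be a real number. Then the function ρ ↦ (ρ^{1/α} + λ)^{-1} is integrable on (0,∞) and λ^α = (λ·sin(απ))/(απ) · ∫₀^∞ (ρ^{1/α} + λ)^{-1} dρ. -/
open MeasureTheory Real

lemma aux_lint (f : ℝ → ℝ) (c : ℝ) (hc : 0 < c) (hf : ∀ x ∈ Set.Ioi (0:ℝ), 0 ≤ f x)
    (h : ∫ x in Set.Ioi (0:ℝ), f x = c) :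
    ∫⁻ x in Set.Ioi (0:ℝ), ENNReal.ofReal (f x) = ENNReal.ofReal c := by
  have hi : Integrable f (volume.restrict (Set.Ioi (0:ℝ))) := by
    by_contra hn
    rw [integral_undef hn] at h
    exact hc.ne h
  rw [← h, ofReal_integral_eq_lintegral_ofReal hi]
  exact (ae_restrict_mem measurableSet_Ioi).mono hf

theorem scalar_integral_representation_of_rpow
    (α lam : ℝ) (hα0 : 0 < α) (hα1 : α < 1) (hlam : 0 < lam) :
    IntegrableOn (fun ρ : ℝ => (ρ ^ (1 / α) + lam)⁻¹) (Set.Ioi 0) ∧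
    lam ^ α = (lam * Real.sin (α * π)) / (α * π) *
      ∫ ρ in Set.Ioi (0 : ℝ), (ρ ^ (1 / α) + lam)⁻¹ := by
  have hG1 : 0 < Real.Gamma (α + 1) := Real.Gamma_pos_of_pos (by linarith)
  have hG2 : 0 < Real.Gamma (1 - α) := Real.Gamma_pos_of_pos (by linarith)
  have hC : 0 < lam ^ (α - 1) * Real.Gamma (1 - α) * Real.Gamma (α + 1) := by positivity
  have h1 : ∀ ρ ∈ Set.Ioi (0:ℝ), ∫⁻ s in Set.Ioi (0:ℝ),
      ENNReal.ofReal (rexp (-s * (ρ ^ (1 / α) + lam))) =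
        ENNReal.ofReal ((ρ ^ (1 / α) + lam)⁻¹) := by
    intro ρ hρ
    have hρ' : (0:ℝ) < ρ := hρ
    have hp : 0 < ρ ^ (1 / α) + lam := by positivity
    apply aux_lint _ _ (by positivity) (fun _ _ => (exp_pos _).le)
    have := integral_exp_mul_Ioi (a := -(ρ ^ (1 / α) + lam)) (by linarith) 0
    simp only [mul_zero, exp_zero] at this
    rw [show (ρ ^ (1 / α) + lam)⁻¹ = -1 / -(ρ ^ (1 / α) + lam) by field_simp, ← this]
    congr 1; ext s; congr 1; ring
  have h2 : ∀ s ∈ Set.Ioi (0:ℝ), ∫⁻ ρ in Set.Ioi (0:ℝ),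
      ENNReal.ofReal (rexp (-s * (ρ ^ (1 / α) + lam))) =
        ENNReal.ofReal (s ^ (-α) * rexp (-(lam * s)) * Real.Gamma (α + 1)) := by
    intro s hs
    have hs' : (0:ℝ) < s := hs
    apply aux_lint _ _ (by positivity) (fun _ _ => (exp_pos _).le)
    have := integral_exp_neg_mul_rpow (p := 1 / α) (b := s) (by positivity) hs
    rw [show -1 / (1 / α) = -α by field_simp, show 1 / (1 / α) + 1 = α + 1 by simp] at this
    rw [mul_right_comm, ← this, ← integral_mul_const]
    congr 1; ext ρ; rw [← exp_add]; congr 1; ring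
  have h3 : ∫⁻ s in Set.Ioi (0:ℝ),
      ENNReal.ofReal (s ^ (-α) * rexp (-(lam * s)) * Real.Gamma (α + 1)) =
        ENNReal.ofReal (lam ^ (α - 1) * Real.Gamma (1 - α) * Real.Gamma (α + 1)) := by
    apply aux_lint _ _ hC
    · intro s hs
      have hs' : (0:ℝ) < s := hs
      positivity
    rw [integral_mul_const]
    have := Real.integral_rpow_mul_exp_neg_mul_Ioi (a := 1 - α) (r := lam) (by linarith) hlam
    rw [show 1 - α - 1 = -α by ring] at this
    rw [this, one_div, Real.inv_rpow hlam.le, ← Real.rpow_neg hlam.le, neg_sub]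
  have hL : ∫⁻ ρ in Set.Ioi (0:ℝ), ENNReal.ofReal ((ρ ^ (1 / α) + lam)⁻¹) =
      ENNReal.ofReal (lam ^ (α - 1) * Real.Gamma (1 - α) * Real.Gamma (α + 1)) := by
    rw [← setLIntegral_congr_fun measurableSet_Ioi h1, lintegral_lintegral_swap,
      setLIntegral_congr_fun measurableSet_Ioi h2, h3]
    apply Measurable.aemeasurable
    unfold Function.uncurry
    fun_prop
  have hnn : 0 ≤ᵐ[volume.restrict (Set.Ioi (0:ℝ))] fun ρ : ℝ => (ρ ^ (1 / α) + lam)⁻¹ := by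
    refine (ae_restrict_mem measurableSet_Ioi).mono fun ρ hρ => ?_
    have hρ' : (0:ℝ) < ρ := hρ
    simp only [Pi.zero_apply]
    positivity
  have hm : Measurable fun ρ : ℝ => (ρ ^ (1 / α) + lam)⁻¹ := by fun_prop
  refine ⟨⟨hm.aestronglyMeasurable, ?_⟩, ?_⟩
  · rw [hasFiniteIntegral_iff_ofReal hnn, hL]
    exact ENNReal.ofReal_lt_top
  · rw [integral_eq_lintegral_of_nonneg_ae hnn hm.aestronglyMeasurable, hL,
      ENNReal.toReal_ofReal hC.le, Real.Gamma_add_one hα0.ne']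
    have hr := Real.Gamma_mul_Gamma_one_sub α
    have hsin : 0 < Real.sin (α * π) :=
      Real.sin_pos_of_pos_of_lt_pi (by positivity) (by nlinarith [pi_pos])
    rw [mul_comm π α] at hr
    rw [show lam ^ (α - 1) * Real.Gamma (1 - α) * (α * Real.Gamma α) =
      lam ^ (α - 1) * α * (Real.Gamma α * Real.Gamma (1 - α)) by ring, hr,
      Real.rpow_sub_one hlam.ne']
    field_simp
end

section
/- Let 0 < α < 1, let λ > 0 and τ > 0 be real numbers. Then the function t ↦ (1−t)^{α−1}(1+t)^{−α}·(τ(1−t) + (1+t)λ)^{-1} is integrable on (−1,1) and λ^α = (2·sin(απ)·τ^α/π) · λ · ∫_{−1}^{1} (1−t)^{α−1}(1+t)^{−α}·(τ(1−t) + (1+t)λ)^{-1} dt. -/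
open MeasureTheory Real

lemma beta_aux_integrable (α : ℝ) (hα0 : 0 < α) (hα1 : α < 1) :
    IntegrableOn (fun x : ℝ => x ^ (α - 1) * (1 - x) ^ (-α)) (Set.Ioo 0 1) ∧
    ∫ x in Set.Ioo (0:ℝ) 1, x ^ (α - 1) * (1 - x) ^ (-α) = π / Real.sin (π * α) := by
  have hc := Complex.betaIntegral_convergent (u := (α : ℂ)) (v := ((1 - α : ℝ) : ℂ))
    (by simpa) (by simpa using hα1)
  rw [intervalIntegrable_iff_integrableOn_Ioo_of_le (by simp)] at hc
  have key : ∀ x ∈ Set.Ioo (0:ℝ) 1,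
      RCLike.re ((x : ℂ) ^ ((α : ℂ) - 1) * (1 - (x : ℂ)) ^ (((1 - α : ℝ) : ℂ) - 1))
        = x ^ (α - 1) * (1 - x) ^ (-α) := by
    intro x hx
    have e1 : (α : ℂ) - 1 = ((α - 1 : ℝ) : ℂ) := by push_cast; ring
    have e2 : ((1 - α : ℝ) : ℂ) - 1 = ((-α : ℝ) : ℂ) := by push_cast; ring
    have e3 : 1 - (x : ℂ) = ((1 - x : ℝ) : ℂ) := by push_cast; ring
    rw [e1, e2, e3, ← Complex.ofReal_cpow hx.1.le, ← Complex.ofReal_cpow (by linarith [hx.2]),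
      ← Complex.ofReal_mul, RCLike.re_to_complex, Complex.ofReal_re]
  refine ⟨?_, ?_⟩
  · have h := hc.re
    exact (integrableOn_congr_fun key measurableSet_Ioo).1 h
  · rw [← setIntegral_congr_fun measurableSet_Ioo key, integral_re hc,
      ← integral_Ioc_eq_integral_Ioo, ← intervalIntegral.integral_of_le (by norm_num)]
    have := ProbabilityTheory.beta_eq_betaIntegralReal α (1 - α) hα0 (by linarith)
    rw [Complex.betaIntegral] at this
    rw [RCLike.re_to_complex, ← this, ProbabilityTheory.beta, Real.Gamma_mul_Gamma_one_sub]
    simp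

theorem scalar_jacobi_integral_representation_of_rpow
    (α lam τ : ℝ) (hα0 : 0 < α) (hα1 : α < 1) (hlam : 0 < lam) (hτ : 0 < τ) :
    IntegrableOn
      (fun t : ℝ => (1 - t) ^ (α - 1) * (1 + t) ^ (-α) * (τ * (1 - t) + (1 + t) * lam)⁻¹)
      (Set.Ioo (-1) 1) ∧
    lam ^ α = (2 * Real.sin (α * π) * τ ^ α / π) * lam *
      ∫ t in Set.Ioo (-1 : ℝ) 1,
        (1 - t) ^ (α - 1) * (1 + t) ^ (-α) * (τ * (1 - t) + (1 + t) * lam)⁻¹ := by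
  obtain ⟨hi, hv⟩ := beta_aux_integrable α hα0 hα1
  set f : ℝ → ℝ := fun t => τ * (1 - t) / (τ * (1 - t) + (1 + t) * lam) with hf
  set f' : ℝ → ℝ := fun t => -(2 * τ * lam) / (τ * (1 - t) + (1 + t) * lam) ^ 2 with hf'
  have hD : ∀ t ∈ Set.Ioo (-1:ℝ) 1, 0 < τ * (1 - t) + (1 + t) * lam := by
    intro t ht
    have h1 : 0 < 1 - t := by linarith [ht.2]
    have h2 : 0 < 1 + t := by linarith [ht.1]
    positivity
  have hder : ∀ t ∈ Set.Ioo (-1:ℝ) 1, HasDerivWithinAt f (f' t) (Set.Ioo (-1) 1) t := by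
    intro t ht
    have hn : HasDerivAt (fun t : ℝ => τ * (1 - t)) (-τ) t := by
      simpa using ((hasDerivAt_id t).const_sub 1).const_mul τ
    have hd : HasDerivAt (fun t : ℝ => τ * (1 - t) + (1 + t) * lam) (-τ + lam) t := by
      simpa using hn.fun_add (((hasDerivAt_id t).const_add 1).mul_const lam)
    have := hn.fun_div hd (hD t ht).ne'
    refine (this.congr_deriv ?_).hasDerivWithinAt
    simp only [hf']
    congr 1
    ring
  have hinj : Set.InjOn f (Set.Ioo (-1) 1) := by
    intro s hs t ht h
    simp only [hf] at h
    rw [div_eq_div_iff (hD s hs).ne' (hD t ht).ne'] at h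
    have h2 : (2 * τ * lam) * (t - s) = 0 := by linear_combination h
    have : (2 * τ * lam) ≠ 0 := by positivity
    have := (mul_eq_zero.1 h2).resolve_left this
    linarith
  have him : f '' Set.Ioo (-1) 1 = Set.Ioo 0 1 := by
    ext u
    constructor
    · rintro ⟨t, ht, rfl⟩
      have h1 : 0 < 1 - t := by linarith [ht.2]
      have h2 : 0 < 1 + t := by linarith [ht.1]
      have h3 : 0 < (1 + t) * lam := by positivity
      refine ⟨div_pos (by positivity) (hD t ht), ?_⟩
      simp only [hf]
      rw [div_lt_one (hD t ht)]
      linarith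
    · rintro ⟨h0, h1⟩
      have h1' : 0 < 1 - u := by linarith
      have hE : 0 < τ * (1 - u) + lam * u := by positivity
      have a1 : 0 < τ * (1 - u) := by positivity
      have a2 : 0 < lam * u := by positivity
      refine ⟨(τ * (1 - u) - lam * u) / (τ * (1 - u) + lam * u), ⟨?_, ?_⟩, ?_⟩
      · rw [lt_div_iff₀ hE]; linarith
      · rw [div_lt_iff₀ hE]; linarith
      · have e1 : 1 - (τ * (1 - u) - lam * u) / (τ * (1 - u) + lam * u)
            = 2 * lam * u / (τ * (1 - u) + lam * u) := by field_simp; ring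
        have e2 : 1 + (τ * (1 - u) - lam * u) / (τ * (1 - u) + lam * u)
            = 2 * τ * (1 - u) / (τ * (1 - u) + lam * u) := by field_simp; ring
        simp only [hf]
        rw [e1, e2]
        have e3 : τ * (2 * lam * u / (τ * (1 - u) + lam * u))
            + 2 * τ * (1 - u) / (τ * (1 - u) + lam * u) * lam
            = 2 * τ * lam / (τ * (1 - u) + lam * u) := by field_simp; ring
        rw [e3]
        field_simp
  have hfun : ∀ t ∈ Set.Ioo (-1:ℝ) 1,
      |f' t| • ((f t) ^ (α - 1) * (1 - f t) ^ (-α)) =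
      (2 * τ ^ α * lam ^ (1 - α)) *
        ((1 - t) ^ (α - 1) * (1 + t) ^ (-α) * (τ * (1 - t) + (1 + t) * lam)⁻¹) := by
    intro t ht
    have h1 : 0 < 1 - t := by linarith [ht.2]
    have h2 : 0 < 1 + t := by linarith [ht.1]
    have hDt := hD t ht
    have e1 : 1 - f t = ((1 + t) * lam) / (τ * (1 - t) + (1 + t) * lam) := by
      simp only [hf]; field_simp; ring
    have e2 : |f' t| = (2 * τ * lam) / (τ * (1 - t) + (1 + t) * lam) ^ 2 := by
      simp only [hf']
      rw [neg_div, abs_neg, abs_of_pos (by positivity)]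
    rw [e1, e2]
    simp only [hf, smul_eq_mul]
    set D := τ * (1 - t) + (1 + t) * lam
    rw [div_rpow (by positivity) hDt.le, div_rpow (by positivity) hDt.le,
      mul_rpow hτ.le h1.le, mul_rpow h2.le hlam.le]
    have p1 : τ ^ α = τ ^ (α - 1) * τ := by rw [rpow_sub_one hτ.ne']; field_simp
    have p2 : lam ^ (1 - α) = lam ^ (-α) * lam := by
      rw [← rpow_add_one hlam.ne']; congr 1; ring
    have p3 : D ^ (-α) = (D ^ (α - 1))⁻¹ * D⁻¹ := by
      rw [rpow_neg hDt.le, rpow_sub_one hDt.ne']; field_simp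
    have hp : D ^ (α - 1) ≠ 0 := (rpow_pos_of_pos hDt _).ne'
    rw [p1, p2, p3]
    field_simp
  have hC : 0 < 2 * τ ^ α * lam ^ (1 - α) := by positivity
  have hI := (integrableOn_image_iff_integrableOn_abs_deriv_smul measurableSet_Ioo hder hinj
    (fun x : ℝ => x ^ (α - 1) * (1 - x) ^ (-α)))
  have hJ := (integral_image_eq_integral_abs_deriv_smul measurableSet_Ioo hder hinj
    (fun x : ℝ => x ^ (α - 1) * (1 - x) ^ (-α)))
  rw [him] at hI hJ
  refine ⟨?_, ?_⟩
  · have h := (integrableOn_congr_fun hfun measurableSet_Ioo).1 (hI.1 hi)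
    exact (integrable_const_mul_iff (isUnit_iff_ne_zero.2 hC.ne') _).1 h
  · rw [hv, setIntegral_congr_fun measurableSet_Ioo hfun, integral_const_mul] at hJ
    set I := ∫ t in Set.Ioo (-1 : ℝ) 1,
        (1 - t) ^ (α - 1) * (1 + t) ^ (-α) * (τ * (1 - t) + (1 + t) * lam)⁻¹
    have hs : 0 < Real.sin (π * α) :=
      sin_pos_of_pos_of_lt_pi (by positivity) (by nlinarith [pi_pos])
    have p2 : lam ^ (1 - α) * lam ^ α = lam := by
      rw [← rpow_add hlam]; simp
    rw [div_eq_iff hs.ne'] at hJ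
    have hpi := pi_pos
    rw [mul_comm α π]
    have : lam ^ α * π = 2 * Real.sin (π * α) * τ ^ α * lam * I := by
      conv_lhs => rw [hJ]
      linear_combination (2 * τ ^ α * I * Real.sin (π * α)) * p2
    field_simp
    linarith
end

section
/- Let p ≥ 1 and N ≥ 1 be natural numbers and let ā₁, …, ā_p be real numbers. Let Ā be the N×N real lower triangular banded Toeplitz matrix with ones on the diagonal, (Ā)_{i+l,i} = ā_l for 1 ≤ l ≤ p, and all other entries zero. Then for every real ξ ≠ −1 the matrix ξI + Ā is invertible; moreover the first component of (ξI + Ā)^{-1}e₁ equals 1/(ξ+1), and there exist real coefficients c_{i,j} (for 2 ≤ i ≤ j ≤ N), independent of ξ, such that for every ξ ≠ −1 and every 2 ≤ j ≤ N the j-th component of (ξI + Ā)^{-1}e₁ equals c_{2,j}/(ξ+1)² + c_{3,j}/(ξ+1)³ + ⋯ + c_{j,j}/(ξ+1)^j. -/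
theorem strictLower_pow_apply {N : ℕ} (B : Matrix (Fin N) (Fin N) ℝ)
    (hB : ∀ i j : Fin N, (i : ℕ) ≤ (j : ℕ) → B i j = 0) (k : ℕ) :
    ∀ i j : Fin N, (i : ℕ) < (j : ℕ) + k → (B ^ k) i j = 0 := by
  induction k with
  | zero =>
    intro i j h
    have hne : i ≠ j := by
      rintro rfl
      omega
    simp [Matrix.one_apply_ne hne]
  | succ k ih =>
    intro i j h
    rw [pow_succ, Matrix.mul_apply]
    apply Finset.sum_eq_zero
    intro m _
    by_cases hm : (m : ℕ) ≤ (j : ℕ)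
    · rw [hB m j hm, mul_zero]
    · rw [ih i m (by omega), zero_mul]

theorem inverse_shifted_banded_toeplitz_first_column
    (p N : ℕ) (hp : 1 ≤ p) (hN : 1 ≤ N) (abar : ℕ → ℝ)
    (A : Matrix (Fin N) (Fin N) ℝ)
    (hA : ∀ i j : Fin N, A i j =
      if (i : ℕ) = (j : ℕ) then 1
      else if (j : ℕ) < (i : ℕ) ∧ (i : ℕ) - (j : ℕ) ≤ p then abar ((i : ℕ) - (j : ℕ)) else 0) :
    ∃ c : ℕ → ℕ → ℝ, ∀ ξ : ℝ, ξ ≠ -1 →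
      IsUnit (ξ • (1 : Matrix (Fin N) (Fin N) ℝ) + A) ∧
      ((ξ • (1 : Matrix (Fin N) (Fin N) ℝ) + A)⁻¹).mulVec (Pi.single ⟨0, hN⟩ 1) ⟨0, hN⟩
        = 1 / (ξ + 1) ∧
      ∀ i : Fin N, 1 ≤ (i : ℕ) →
        ((ξ • (1 : Matrix (Fin N) (Fin N) ℝ) + A)⁻¹).mulVec (Pi.single ⟨0, hN⟩ 1) i
          = ∑ l ∈ Finset.Icc 2 ((i : ℕ) + 1), c l ((i : ℕ) + 1) / (ξ + 1) ^ l := by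
  classical
  set B : Matrix (Fin N) (Fin N) ℝ := 1 - A with hBdef
  have hB : ∀ i j : Fin N, (i : ℕ) ≤ (j : ℕ) → B i j = 0 := by
    intro i j hij
    rw [hBdef, Matrix.sub_apply, hA i j]
    by_cases h : i = j
    · subst h
      simp
    · have h' : (i : ℕ) ≠ (j : ℕ) := fun e => h (Fin.ext e)
      rw [Matrix.one_apply_ne h, if_neg h', if_neg (by omega), sub_zero]
  have hpow := strictLower_pow_apply B hB
  have hnil : B ^ N = 0 := by
    ext i j
    exact hpow N i j (by omega)
  refine ⟨fun l j => if h : j - 1 < N then (B ^ (l - 1)) ⟨j - 1, h⟩ ⟨0, hN⟩ else 0, ?_⟩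
  intro ξ hξ
  have ht : ξ + 1 ≠ 0 := fun h => hξ (by linarith)
  have hM : ξ • (1 : Matrix (Fin N) (Fin N) ℝ) + A = (ξ + 1) • (1 - (ξ + 1)⁻¹ • B) := by
    rw [smul_sub, smul_smul, mul_inv_cancel₀ ht, one_smul, add_smul, one_smul, hBdef]
    abel
  have hinv : (ξ • (1 : Matrix (Fin N) (Fin N) ℝ) + A) *
      ((ξ + 1)⁻¹ • ∑ k ∈ Finset.range N, ((ξ + 1)⁻¹ • B) ^ k) = 1 := by
    rw [hM, smul_mul_smul_comm, mul_inv_cancel₀ ht, one_smul, mul_neg_geom_sum, smul_pow, hnil,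
      smul_zero, sub_zero]
  have hcomp : ∀ i : Fin N,
      ((ξ • (1 : Matrix (Fin N) (Fin N) ℝ) + A)⁻¹).mulVec (Pi.single ⟨0, hN⟩ 1) i
        = ∑ k ∈ Finset.range N, (B ^ k) i ⟨0, hN⟩ / (ξ + 1) ^ (k + 1) := by
    intro i
    rw [Matrix.inv_eq_right_inv hinv, Matrix.mulVec_single_one, Matrix.col_apply,
      Matrix.smul_apply, Matrix.sum_apply, smul_eq_mul, Finset.mul_sum]
    apply Finset.sum_congr rfl
    intro k _
    rw [smul_pow, Matrix.smul_apply, smul_eq_mul, inv_pow]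
    field_simp
    ring
  refine ⟨IsUnit.of_mul_eq_one _ hinv, ?_, ?_⟩
  · rw [hcomp, Finset.sum_eq_single 0]
    · simp
    · intro k _ hk
      rw [hpow k _ _ (by simp; omega), zero_div]
    · intro h
      simp at h
      omega
  · intro i hi
    rw [hcomp]
    have hI : Finset.Icc 2 ((i : ℕ) + 1) = (Finset.Icc 1 (i : ℕ)).image (· + 1) := by
      simp
    rw [hI, Finset.sum_image (by intro a _ b _ h; simpa using h)]
    symm
    have hsub : Finset.Icc 1 (i : ℕ) ⊆ Finset.range N := by
      intro k hk
      simp only [Finset.mem_Icc, Finset.mem_range] at hk ⊢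
      omega
    rw [← Finset.sum_subset hsub]
    · apply Finset.sum_congr rfl
      intro k _
      simp
    · intro k _ hk
      simp only [Finset.mem_Icc, not_and_or, not_le] at hk
      rcases Nat.eq_zero_or_pos k with h0 | h0
      · subst h0
        have hne : i ≠ ⟨0, hN⟩ := by
          rintro rfl
          simp at hi
        rw [pow_zero, Matrix.one_apply_ne hne, zero_div]
      · rw [hpow k _ _ (by simp; omega), zero_div]
end

section
/- Let 0 < τ < 1, set a := (1+τ)/(1−τ), and for a natural number j ≥ 1 define f_j : ℝ → ℝ by f_j(t) = (1+t)^{j−1}/(τ(1−t)+1+t)^j. Then for every natural number k and every t ∈ [−1,1], |f_j^{(2k)}(t)| ≤ (2k)! · √a/(√a − 1)^{2k+2} · ((a+1)/(2√a))^j, where f_j^{(2k)} denotes the 2k-th derivative of f_j. -/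
/-- Transfer of iterated derivatives from a complex extension to the real line. -/
theorem iterDeriv_real_eq (f : ℝ → ℝ) (G : ℂ → ℂ) (a : ℝ)
    (hG : AnalyticOnNhd ℂ G {z : ℂ | -a < z.re})
    (hfG : ∀ t : ℝ, -a < t → f t = (G t).re) :
    ∀ n : ℕ, ∀ t : ℝ, -a < t → iteratedDeriv n f t = (iteratedDeriv n G t).re := by
  intro n
  induction n with
  | zero => intro t ht; simpa using hfG t ht
  | succ n ih =>
    intro t ht
    rw [iteratedDeriv_succ, iteratedDeriv_succ]
    have h1 : iteratedDeriv n f =ᶠ[nhds t] fun x : ℝ => (iteratedDeriv n G x).re := by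
      filter_upwards [Ioi_mem_nhds ht] with x hx using ih x hx
    rw [h1.deriv_eq]
    have h2 : DifferentiableAt ℂ (iteratedDeriv n G) (t : ℂ) := by
      have := hG.iterated_deriv n (t : ℂ) (by simpa using ht)
      rw [← iteratedDeriv_eq_iterate] at this
      exact this.differentiableAt
    exact h2.hasDerivAt.real_of_complex.deriv

/-- On the disc of radius `s = √a` the quotient is small. -/
theorem apollonius (s : ℝ) (hs : 1 < s) (z : ℂ) (hz : ‖z‖ ≤ s) :
    s * ‖1 + z‖ ≤ ‖((s ^ 2 : ℝ) : ℂ) + z‖ := by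
  have h0 : 0 ≤ ‖z‖ := norm_nonneg z
  have h1 : ‖z‖ ^ 2 = z.re ^ 2 + z.im ^ 2 := by
    rw [← Complex.normSq_eq_norm_sq, Complex.normSq_apply]; ring
  have h2 : z.re ^ 2 + z.im ^ 2 ≤ s ^ 2 := by rw [← h1]; gcongr
  apply le_of_sq_le_sq _ (norm_nonneg _)
  rw [mul_pow, ← Complex.normSq_eq_norm_sq, ← Complex.normSq_eq_norm_sq, Complex.normSq_apply,
    Complex.normSq_apply]
  simp only [Complex.add_re, Complex.add_im, Complex.one_re, Complex.one_im, Complex.ofReal_re,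
    Complex.ofReal_im]
  nlinarith [mul_nonneg (by nlinarith : (0 : ℝ) ≤ s ^ 2 - 1) (sub_nonneg.2 h2)]

theorem deriv_bound_global_circle
    (τ : ℝ) (hτ0 : 0 < τ) (hτ1 : τ < 1) (a : ℝ) (ha : a = (1 + τ) / (1 - τ))
    (j : ℕ) (hj : 1 ≤ j)
    (f : ℝ → ℝ) (hf : ∀ t : ℝ, f t = (1 + t) ^ (j - 1) / (τ * (1 - t) + 1 + t) ^ j) :
    ∀ k : ℕ, ∀ t ∈ Set.Icc (-1 : ℝ) 1,
      |iteratedDeriv (2 * k) f t| ≤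
        (2 * k).factorial * Real.sqrt a / (Real.sqrt a - 1) ^ (2 * k + 2) *
          ((a + 1) / (2 * Real.sqrt a)) ^ j := by
  intro k t ht
  have hτ : 0 < 1 - τ := by linarith
  have ha1 : 1 < a := by rw [ha, lt_div_iff₀ hτ]; linarith
  set s := Real.sqrt a with hsdef
  have hs2 : s ^ 2 = a := Real.sq_sqrt (by linarith)
  have hs : 1 < s := by rw [hsdef]; exact Real.lt_sqrt_of_sq_lt (by simpa using ha1)
  have hτa : τ * (a + 1) = a - 1 := by rw [ha]; field_simp; ring
  obtain ⟨m, rfl⟩ : ∃ m, j = m + 1 := ⟨j - 1, by omega⟩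
  simp only [Nat.add_sub_cancel] at hf
  let c : ℝ := ((a + 1) / 2) ^ (m + 1)
  let G : ℂ → ℂ := fun z => (c : ℂ) * ((1 + z) ^ m / ((a : ℂ) + z) ^ (m + 1))
  have hne : ∀ z : ℂ, -a < z.re → (a : ℂ) + z ≠ 0 := by
    intro z hz h
    have := congrArg Complex.re h
    simp at this
    linarith
  have hG : AnalyticOnNhd ℂ G {z : ℂ | -a < z.re} := by
    apply DifferentiableOn.analyticOnNhd
    · intro z hz
      have := pow_ne_zero (m + 1) (hne z hz)
      apply DifferentiableAt.differentiableWithinAt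
      fun_prop (disch := exact this)
    · exact isOpen_lt continuous_const Complex.continuous_re
  have hfG : ∀ t : ℝ, -a < t → f t = (G t).re := by
    intro t ht
    have : G t = ((c * ((1 + t) ^ m / (a + t) ^ (m + 1)) : ℝ) : ℂ) := by
      simp [G]
    rw [this, Complex.ofReal_re, hf]
    have h3 : τ * (1 - t) + 1 + t = (a + t) / ((a + 1) / 2) := by
      field_simp
      linear_combination (1 - t) * hτa
    rw [h3, div_pow]
    simp only [c]
    have : (a + t) ≠ 0 := by linarith
    have : (a + 1) ≠ 0 := by linarith
    field_simp
  rw [iterDeriv_real_eq f G a hG hfG (2 * k) t (by linarith [ht.1])]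
  refine (Complex.abs_re_le_norm _).trans ?_
  have hR : 0 < s - 1 := by linarith
  have hball : ∀ z ∈ Metric.closedBall (t : ℂ) (s - 1), ‖z‖ ≤ s := by
    intro z hz
    rw [Metric.mem_closedBall, dist_eq_norm] at hz
    have : ‖(t : ℂ)‖ ≤ 1 := by
      rw [Complex.norm_real]; exact abs_le.2 ht
    have := norm_add_le (z - t) (t : ℂ)
    rw [sub_add_cancel] at this
    linarith
  have hre : ∀ z ∈ Metric.closedBall (t : ℂ) (s - 1), -a < z.re := by
    intro z hz
    have h1 := hball z hz
    have h2 := (abs_le.1 (Complex.abs_re_le_norm z)).1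
    nlinarith
  have hc : 0 < c := by positivity
  have hbound : ∀ z ∈ Metric.sphere (t : ℂ) (s - 1), ‖G z‖ ≤ c * (1 / s ^ (m + 1) / (s - 1)) := by
    intro z hz
    have hz' := Metric.sphere_subset_closedBall hz
    have h1 := apollonius s hs z (hball z hz')
    rw [hs2] at h1
    have h2 : s * (s - 1) ≤ ‖(a : ℂ) + z‖ := by
      have h3 := norm_sub_le ((a : ℂ) + z) z
      rw [add_sub_cancel_right, Complex.norm_real, Real.norm_of_nonneg (by linarith)] at h3
      nlinarith [hball z hz']
    have hpos : 0 < ‖(a : ℂ) + z‖ := lt_of_lt_of_le (by positivity) h2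
    simp only [G]
    rw [norm_mul, norm_div, norm_pow, norm_pow, Complex.norm_real, Real.norm_of_nonneg hc.le]
    refine mul_le_mul_of_nonneg_left ?_ hc.le
    rw [div_div, div_le_div_iff₀ (by positivity) (by positivity), one_mul]
    calc ‖1 + z‖ ^ m * (s ^ (m + 1) * (s - 1)) = (s * ‖1 + z‖) ^ m * (s * (s - 1)) := by ring
      _ ≤ ‖(a : ℂ) + z‖ ^ m * ‖(a : ℂ) + z‖ := by gcongr
      _ = _ := by ring
  have hd : DiffContOnCl ℂ G (Metric.ball (t : ℂ) (s - 1)) := by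
    apply DifferentiableOn.diffContOnCl_ball (U := {z : ℂ | -a < z.re}) hG.differentiableOn
    exact hre
  have key := Complex.norm_iteratedDeriv_le_of_forall_mem_sphere_norm_le (2 * k) hR hd hbound
  refine key.trans ?_
  have e : ((a + 1) / (2 * s)) ^ (m + 1) = c * (1 / s ^ (m + 1)) := by
    simp only [c]; rw [← div_div, div_pow]; ring
  rw [e]
  have : (2 * k).factorial * (c * (1 / s ^ (m + 1) / (s - 1))) / (s - 1) ^ (2 * k)
      = (2 * k).factorial * (s - 1) / (s - 1) ^ (2 * k + 2) * (c * (1 / s ^ (m + 1))) := by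
    field_simp
    ring
  rw [this]
  gcongr
  linarith
end

section
/- Let 0 < τ < 1, set a := (1+τ)/(1−τ), and for a natural number j ≥ 1 define f_j : ℝ → ℝ by f_j(t) = (1+t)^{j−1}/(τ(1−t)+1+t)^j. Then for all natural numbers k and j with j ≥ 2k+2 and every t ∈ [−1,1], |f_j^{(2k)}(t)| ≤ (2k)! · (√(a+1) + √2)/(a−1) · (1+t)^{(j−1)/2−k} · (a+t)^{−(j/2+k)} · ((a+1)/2)^j, where f_j^{(2k)} is the 2k-th derivative of f_j and the powers of (1+t) and (a+t) are real powers. -/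
theorem aux_real_complex (a : ℝ) (F : ℂ → ℂ) (f : ℝ → ℝ)
    (hF : DifferentiableOn ℂ F {z | z ≠ -(a : ℂ)})
    (hf : ∀ t : ℝ, F t = f t) (n : ℕ) :
    ∀ t : ℝ, -a < t → iteratedDeriv n F t = (iteratedDeriv n f t : ℝ) := by
  have ho : IsOpen {z : ℂ | z ≠ -(a : ℂ)} := isOpen_ne
  have hd : ∀ n, DifferentiableOn ℂ (iteratedDeriv n F) {z | z ≠ -(a : ℂ)} := by
    intro n
    induction n with
    | zero => simpa using hF
    | succ n ih => rw [iteratedDeriv_succ]; exact ih.deriv ho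
  induction n with
  | zero => intro t _; simpa using hf t
  | succ n ih =>
    intro t ht
    have hne : (t : ℂ) ∈ {z : ℂ | z ≠ -(a : ℂ)} := by
      intro h
      have : t = -a := by exact_mod_cast h
      linarith
    have h1 : HasDerivAt (iteratedDeriv n F) (iteratedDeriv (n+1) F t) (t : ℂ) := by
      rw [iteratedDeriv_succ]
      exact ((hd n).differentiableAt (ho.mem_nhds hne)).hasDerivAt
    have h2 := h1.comp_ofReal
    have hev : (fun s : ℝ => iteratedDeriv n F (s : ℂ)) =ᶠ[nhds t]
        fun s : ℝ => ((iteratedDeriv n f s : ℝ) : ℂ) := by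
      filter_upwards [Ioi_mem_nhds ht] with s hs using ih s hs
    have h3 := h2.congr_of_eventuallyEq hev.symm
    have h4 : HasDerivAt (iteratedDeriv n f) (iteratedDeriv (n+1) F t).re t := by
      have := (Complex.reCLM.hasFDerivAt.comp_hasDerivAt t h3)
      simpa [Function.comp_def] using this
    have h5 := h4.ofReal_comp
    have h6 := h3.unique h5
    rw [h6, iteratedDeriv_succ (f := f), h4.deriv]

theorem aux_sphere (x y : ℝ) (hx : 0 < x) (hxy : x < y) (m : ℕ) (w : ℂ) (hw : ‖w‖ = x * y) :
    ‖((x^2 : ℝ) + w) ^ m / ((y^2 : ℝ) + w) ^ (m+1)‖ ≤ x ^ m / y ^ (m+1) / (y - x) := by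
  have hy : 0 < y := hx.trans hxy
  have hN : y * (y - x) ≤ ‖((y^2 : ℝ) : ℂ) + w‖ := by
    have h := norm_sub_le_norm_add ((y^2 : ℝ) : ℂ) w
    rw [hw, Complex.norm_real, Real.norm_of_nonneg (by positivity)] at h
    nlinarith
  have hN0 : 0 < y * (y - x) := mul_pos hy (by linarith)
  have hw2 : w.re ^ 2 + w.im ^ 2 = (x * y) ^ 2 := by
    rw [← hw, Complex.sq_norm, Complex.normSq_apply]; ring
  have hE : ‖((x^2 : ℝ) : ℂ) + w‖ = x / y * ‖((y^2 : ℝ) : ℂ) + w‖ := by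
    rw [← sq_eq_sq₀ (norm_nonneg _) (by positivity), mul_pow, Complex.sq_norm, Complex.sq_norm,
      Complex.normSq_apply, Complex.normSq_apply]
    simp only [Complex.add_re, Complex.add_im, Complex.ofReal_re, Complex.ofReal_im]
    field_simp
    linear_combination (y ^ 2 - x ^ 2) * hw2
  rw [norm_div, norm_pow, norm_pow, hE]
  set N := ‖((y^2 : ℝ) : ℂ) + w‖
  have hNp : 0 < N := hN0.trans_le hN
  have e1 : (x / y * N) ^ m / N ^ (m+1) = (x/y)^m / N := by
    rw [mul_pow, pow_succ]; field_simp
  have e2 : x ^ m / y ^ (m+1) / (y - x) = (x/y)^m / (y * (y-x)) := by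
    rw [div_pow, pow_succ]; field_simp
  rw [e1, e2]
  gcongr

theorem deriv_bound_pointwise
    (τ : ℝ) (hτ0 : 0 < τ) (hτ1 : τ < 1) (a : ℝ) (ha : a = (1 + τ) / (1 - τ))
    (j k : ℕ) (hjk : 2 * k + 2 ≤ j)
    (f : ℝ → ℝ) (hf : ∀ t : ℝ, f t = (1 + t) ^ (j - 1) / (τ * (1 - t) + 1 + t) ^ j) :
    ∀ t ∈ Set.Icc (-1 : ℝ) 1,
      |iteratedDeriv (2 * k) f t| ≤
        (2 * k).factorial * ((Real.sqrt (a + 1) + Real.sqrt 2) / (a - 1)) *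
          (1 + t) ^ (((j : ℝ) - 1) / 2 - k) * (a + t) ^ (-((j : ℝ) / 2 + k)) *
          ((a + 1) / 2) ^ j := by
  obtain ⟨m, rfl⟩ : ∃ m, j = m + 1 := ⟨j - 1, by omega⟩
  have h1τ : 0 < 1 - τ := by linarith
  have ha1 : 1 < a := by rw [ha, lt_div_iff₀ h1τ]; linarith
  have hc : (a + 1) / 2 = (1 - τ)⁻¹ := by rw [ha]; field_simp; ring
  set c : ℝ := ((a + 1) / 2) ^ (m + 1) with hcdef
  have hc0 : 0 < c := by positivity
  have hf' : ∀ t : ℝ, f t = c * ((1 + t) ^ m / (a + t) ^ (m + 1)) := by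
    intro t
    have : τ * (1 - t) + 1 + t = (1 - τ) * (a + t) := by rw [ha]; field_simp; ring
    rw [hf, this, hcdef, hc, mul_pow, inv_pow, Nat.add_sub_cancel, div_eq_mul_inv, mul_inv]
    ring
  set F : ℂ → ℂ := fun z => c * ((1 + z) ^ m / (a + z) ^ (m + 1)) with hFdef
  have hFf : ∀ t : ℝ, F t = f t := by
    intro t; rw [hf', hFdef]; push_cast; rfl
  have hne : ∀ z : ℂ, z ≠ -(a : ℂ) → (a : ℂ) + z ≠ 0 := by
    intro z hz h; exact hz (by linear_combination h)
  have hFd : DifferentiableOn ℂ F {z | z ≠ -(a : ℂ)} := by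
    intro z hz
    have : ((a : ℂ) + z) ^ (m + 1) ≠ 0 := pow_ne_zero _ (hne z hz)
    apply DifferentiableAt.differentiableWithinAt
    rw [hFdef]
    fun_prop (disch := assumption)
  have key := aux_real_complex a F f hFd hFf
  have hmain : ∀ t ∈ Set.Ioc (-1 : ℝ) 1,
      |iteratedDeriv (2 * k) f t| ≤
        (2 * k).factorial * ((Real.sqrt (a + 1) + Real.sqrt 2) / (a - 1)) *
          (1 + t) ^ ((((m + 1 : ℕ) : ℝ) - 1) / 2 - k) *
          (a + t) ^ (-(((m + 1 : ℕ) : ℝ) / 2 + k)) * c := by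
    intro t ht
    obtain ⟨ht0, ht1⟩ := ht
    have hp : 0 < 1 + t := by linarith
    have hq : 0 < a + t := by linarith
    obtain ⟨x, hx⟩ : ∃ x, x = Real.sqrt (1 + t) := ⟨_, rfl⟩
    obtain ⟨y, hy⟩ : ∃ y, y = Real.sqrt (a + t) := ⟨_, rfl⟩
    have hx0 : 0 < x := hx ▸ Real.sqrt_pos.2 hp
    have hy0 : 0 < y := hy ▸ Real.sqrt_pos.2 hq
    have hxp : 1 + t = x ^ 2 := by rw [hx, Real.sq_sqrt hp.le]
    have hyq : a + t = y ^ 2 := by rw [hy, Real.sq_sqrt hq.le]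
    have hxy : x < y := by rw [hx, hy]; exact Real.sqrt_lt_sqrt hp.le (by linarith)
    have hx2 : x ≤ Real.sqrt 2 := by rw [hx]; exact Real.sqrt_le_sqrt (by linarith)
    have hy2 : y ≤ Real.sqrt (a + 1) := by rw [hy]; exact Real.sqrt_le_sqrt (by linarith)
    have hball : DiffContOnCl ℂ F (Metric.ball (t : ℂ) (x * y)) := by
      apply DifferentiableOn.diffContOnCl
      apply hFd.mono
      intro z hz h
      have hz' := Metric.closure_ball_subset_closedBall hz
      rw [h, Metric.mem_closedBall, dist_eq_norm,
        show (-(a : ℂ) - t) = ((-(y ^ 2) : ℝ) : ℂ) by rw [← hyq]; push_cast; ring,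
        Complex.norm_real, norm_neg, Real.norm_of_nonneg (by positivity)] at hz'
      nlinarith
    have hb := Complex.norm_iteratedDeriv_le_of_forall_mem_sphere_norm_le (2 * k)
      (mul_pos hx0 hy0) hball (C := c * (x ^ m / y ^ (m+1) / (y - x))) (by
        intro z hz
        have h := aux_sphere x y hx0 hxy m (z - t) (by simpa [dist_eq_norm] using hz)
        rw [← hxp, ← hyq] at h
        have e1 : ((1 + t : ℝ) : ℂ) + (z - t) = 1 + z := by push_cast; ring
        have e2 : ((a + t : ℝ) : ℂ) + (z - t) = a + z := by push_cast; ring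
        rw [e1, e2] at h
        rw [hFdef]
        simp only []
        rw [norm_mul, Complex.norm_real, Real.norm_of_nonneg hc0.le]
        gcongr)
    rw [key (2 * k) t (by linarith), Complex.norm_real, Real.norm_eq_abs] at hb
    refine hb.trans ?_
    have r1 : (1 + t) ^ ((((m + 1 : ℕ) : ℝ) - 1) / 2 - k) = x ^ m / x ^ (2 * k) := by
      rw [hxp, ← Real.rpow_natCast x 2, ← Real.rpow_mul hx0.le, ← Real.rpow_natCast,
        ← Real.rpow_natCast, ← Real.rpow_sub hx0]
      congr 1; push_cast; ring
    have r2 : (a + t) ^ (-(((m + 1 : ℕ) : ℝ) / 2 + k)) = (y ^ (m + 1) * y ^ (2 * k))⁻¹ := by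
      rw [hyq, ← Real.rpow_natCast y 2, ← Real.rpow_mul hy0.le, ← Real.rpow_natCast,
        ← Real.rpow_natCast, ← Real.rpow_add hy0, ← Real.rpow_neg hy0.le]
      congr 1; push_cast; ring
    rw [r1, r2]
    have hyx : 0 < y - x := by linarith
    have ham : a - 1 = (y - x) * (y + x) := by nlinarith
    have hS : (y - x)⁻¹ ≤ (Real.sqrt (a + 1) + Real.sqrt 2) / (a - 1) := by
      have : (y - x)⁻¹ = (y + x) / (a - 1) := by rw [ham]; field_simp
      rw [this]
      have : 0 < a - 1 := by linarith
      gcongr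
    calc _ = (2 * k).factorial * (y - x)⁻¹ * (x ^ m / x ^ (2 * k)) *
          (y ^ (m + 1) * y ^ (2 * k))⁻¹ * c := by
          rw [mul_pow]; field_simp
      _ ≤ _ := by gcongr
  intro t ht
  rcases ht.1.eq_or_lt with h | h
  swap
  · exact hmain t ⟨h, ht.2⟩
  subst h
  have hcd : ContinuousAt (iteratedDeriv (2 * k) f) (-1) := by
    have hh : ContDiffOn ℝ (2 * k : ℕ) f (Set.Ioi (-a)) := by
      intro s hs
      have : (a + s) ^ (m + 1) ≠ 0 := pow_ne_zero _ (by have : -a < s := hs; linarith)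
      rw [funext hf']
      apply ContDiffAt.contDiffWithinAt
      fun_prop (disch := assumption)
    have h2 := hh.continuousOn_iteratedDerivWithin le_rfl (uniqueDiffOn_Ioi _)
    have h3 := h2.continuousAt (Ioi_mem_nhds (show -a < -1 by linarith))
    refine h3.congr ?_
    filter_upwards [Ioi_mem_nhds (show -a < -1 by linarith)] with s hs
    exact iteratedDerivWithin_of_isOpen isOpen_Ioi hs
  have hcR : ContinuousAt (fun t : ℝ => (2 * k).factorial *
        ((Real.sqrt (a + 1) + Real.sqrt 2) / (a - 1)) *
          (1 + t) ^ ((((m + 1 : ℕ) : ℝ) - 1) / 2 - k) *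
          (a + t) ^ (-(((m + 1 : ℕ) : ℝ) / 2 + k)) * c) (-1) := by
    have hm : (2 * k + 1 : ℝ) ≤ m := by exact_mod_cast (by omega : 2 * k + 1 ≤ m)
    have c1 : ContinuousAt (fun t : ℝ => (1 + t) ^ ((((m + 1 : ℕ) : ℝ) - 1) / 2 - k)) (-1) := by
      apply ContinuousAt.rpow_const (by fun_prop)
      right; push_cast; linarith
    have c2 : ContinuousAt (fun t : ℝ => (a + t) ^ (-(((m + 1 : ℕ) : ℝ) / 2 + k))) (-1) := by
      apply ContinuousAt.rpow_const (by fun_prop)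
      left; linarith
    exact ((continuousAt_const.mul c1).mul c2).mul continuousAt_const
  have l1 : Filter.Tendsto (fun s => |iteratedDeriv (2 * k) f s|) (nhdsWithin (-1) (Set.Ioi (-1)))
      (nhds |iteratedDeriv (2 * k) f (-1)|) := (hcd.abs).tendsto.mono_left nhdsWithin_le_nhds
  have l2 := hcR.tendsto.mono_left (nhdsWithin_le_nhds (s := Set.Ioi (-1)))
  refine le_of_tendsto_of_tendsto l1 l2 ?_
  filter_upwards [Ioc_mem_nhdsGT (show (-1 : ℝ) < 1 by norm_num)] with s hs using hmain s hs
end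

section
/- Let 0 < τ < 1 and set a := (1+τ)/(1−τ). For a natural number j ≥ 1 define f_j : ℝ → ℝ by f_j(t) = (1+t)^{j−1}/(τ(1−t)+1+t)^j. If k and j are natural numbers with j ≥ 2k+2 and a ≤ (j+6k+1)/(j−2k−1), then for every t ∈ [−1,1], |f_j^{(2k)}(t)| ≤ (2k)! · (√(a+1) + √2) · ((j−2k−1)/(4k+1))^{(j−1)/2−k} / ((j+2k)/(4k+1))^{j/2+k} · ((a+1)/2)^j · (a−1)^{−2k−3/2}. -/
lemma aux_max (x b p q : ℝ) (hx : 0 < x) (hb : 0 < b) (hp : 0 < p) (hpq : p < q) :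
    x ^ p / (x + b) ^ q ≤ ((p / (q - p)) ^ p / (q / (q - p)) ^ q) * b ^ (p - q) := by
  have hq : 0 < q := hp.trans hpq
  have hd : 0 < q - p := by linarith
  set A := p / (q - p) with hA
  set B := q / (q - p) with hB
  have hA0 : 0 < A := by positivity
  have hB0 : 0 < B := by positivity
  have h := Real.geom_mean_le_arith_mean2_weighted (w₁ := p / q) (w₂ := (q - p) / q)
    (p₁ := x / (b * A)) (p₂ := 1) (by positivity) (by positivity) (by positivity) (by positivity)
    (by field_simp; ring)
  rw [Real.one_rpow, mul_one, mul_one] at h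
  have e : p / q * (x / (b * A)) + (q - p) / q = (x + b) / (b * B) := by
    rw [hA, hB]; field_simp
  rw [e] at h
  have h2 := Real.rpow_le_rpow (by positivity) h hq.le
  rw [← Real.rpow_mul (by positivity), div_mul_cancel₀ _ hq.ne',
    Real.div_rpow hx.le (by positivity), Real.div_rpow (by positivity) (by positivity),
    Real.mul_rpow hb.le hA0.le, Real.mul_rpow hb.le hB0.le] at h2
  rw [Real.rpow_sub hb]
  have h3 : 0 < x ^ p := by positivity
  have h4 : 0 < (x + b) ^ q := by positivity
  have h5 : 0 < b ^ p := by positivity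
  have h6 : 0 < b ^ q := by positivity
  have h7 : 0 < A ^ p := by positivity
  have h8 : 0 < B ^ q := by positivity
  rw [div_mul_div_comm, div_le_div_iff₀ (by positivity) (by positivity)]
  rw [div_le_div_iff₀ (by positivity) (by positivity)] at h2
  linarith

lemma aux_sphere_s9 (s y : ℝ) (hs : 0 < s) (hsy : s < y) (w : ℂ)
    (hw : ‖w - (s ^ 2 : ℝ)‖ = s * y) :
    ‖w‖ = s / y * ‖w + ((y ^ 2 - s ^ 2 : ℝ) : ℂ)‖ ∧ y * (y - s) ≤ ‖w + ((y ^ 2 - s ^ 2 : ℝ) : ℂ)‖ := by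
  have hy : 0 < y := hs.trans hsy
  constructor
  · have h1 : ‖w - (s ^ 2 : ℝ)‖ ^ 2 = (s * y) ^ 2 := by rw [hw]
    rw [← Complex.normSq_eq_norm_sq, Complex.normSq_apply] at h1
    simp only [Complex.sub_re, Complex.sub_im, Complex.ofReal_re, Complex.ofReal_im] at h1
    rw [← sq_eq_sq₀ (by positivity) (by positivity), mul_pow,
      ← Complex.normSq_eq_norm_sq, ← Complex.normSq_eq_norm_sq, Complex.normSq_apply,
      Complex.normSq_apply]
    simp only [Complex.add_re, Complex.add_im, Complex.ofReal_re, Complex.ofReal_im]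
    field_simp
    linear_combination (y ^ 2 - s ^ 2) * h1
  · have h := norm_sub_le (w + ((y ^ 2 - s ^ 2 : ℝ) : ℂ)) (w - (s ^ 2 : ℝ))
    have e : (w + ((y ^ 2 - s ^ 2 : ℝ) : ℂ)) - (w - (s ^ 2 : ℝ)) = ((y ^ 2 : ℝ) : ℂ) := by
      push_cast; ring
    rw [e, hw, Complex.norm_real, Real.norm_of_nonneg (by positivity)] at h
    linarith

lemma aux_real (f : ℝ → ℝ) (F : ℂ → ℂ) (U : Set ℂ) (hU : IsOpen U)
    (hF : DifferentiableOn ℂ F U) (hfF : ∀ t : ℝ, f t = (F t).re) (n : ℕ) :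
    ∀ t : ℝ, (t : ℂ) ∈ U → iteratedDeriv n f t = (iteratedDeriv n F t).re := by
  have hd : ∀ n : ℕ, ∀ z ∈ U, AnalyticAt ℂ (iteratedDeriv n F) z := fun n z hz =>
    by
    rw [iteratedDeriv_eq_iterate]
    exact (hF.analyticOnNhd hU).iterated_deriv n z hz
  induction n with
  | zero => intro t _; simpa using hfF t
  | succ n ih =>
    intro t ht
    have hev : ∀ᶠ u : ℝ in nhds t, (u : ℂ) ∈ U :=
      Complex.continuous_ofReal.continuousAt.eventually (hU.mem_nhds ht)
    rw [iteratedDeriv_succ, iteratedDeriv_succ]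
    have := ((hd n t ht).differentiableAt.hasDerivAt).real_of_complex
    rw [← this.deriv]
    apply Filter.EventuallyEq.deriv_eq
    filter_upwards [hev] with u hu using ih u hu

lemma aux_final (x b : ℝ) (j k : ℕ) (hjk : 2 * k + 2 ≤ j) (hx : 0 < x) (hx2 : x ≤ 2)
    (hb : 0 < b) (s y : ℝ) (hs : s = √x) (hy : y = √(x + b)) :
    (s / y) ^ (j - 1) / (y * (y - s)) / (s * y) ^ (2 * k) ≤
      (√(b + 2) + √2) * ((((j : ℝ) - 2 * k - 1) / (4 * k + 1)) ^ (((j : ℝ) - 1) / 2 - k) /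
            (((j : ℝ) + 2 * k) / (4 * k + 1)) ^ ((j : ℝ) / 2 + k)) * 
            b ^ (-2 * (k : ℝ) - 3 / 2) := by
  have hj : (2 * k + 2 : ℝ) ≤ j := by exact_mod_cast hjk
  have hs0 : 0 < s := by rw [hs]; positivity
  have hsy : s < y := by rw [hs, hy]; exact Real.sqrt_lt_sqrt hx.le (by linarith)
  have hy0 : 0 < y := hs0.trans hsy
  have hs2 : s ^ 2 = x := by rw [hs]; exact Real.sq_sqrt hx.le
  have hy2 : y ^ 2 = x + b := by rw [hy]; exact Real.sq_sqrt (by positivity)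
  have h := aux_max x b (((j : ℝ) - 1) / 2 - k) ((j : ℝ) / 2 + k) hx hb (by linarith) (by
    have : (0:ℝ) ≤ k := by positivity
    linarith)
  have hk : (0 : ℝ) < 4 * k + 1 := by positivity
  have e1 : (((j : ℝ) - 1) / 2 - k) / (((j : ℝ) / 2 + k) - (((j : ℝ) - 1) / 2 - k))
      = ((j : ℝ) - 2 * k - 1) / (4 * k + 1) := by
    rw [div_eq_div_iff (by linarith) (by linarith)]; ring
  have e2 : ((j : ℝ) / 2 + k) / (((j : ℝ) / 2 + k) - (((j : ℝ) - 1) / 2 - k))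
      = ((j : ℝ) + 2 * k) / (4 * k + 1) := by
    rw [div_eq_div_iff (by linarith) (by linarith)]; ring
  rw [e1, e2] at h
  have e3 : (((j : ℝ) - 1) / 2 - k) - ((j : ℝ) / 2 + k) = (-2 * (k : ℝ) - 3 / 2) + 1 := by ring
  rw [e3, Real.rpow_add_one hb.ne'] at h
  obtain ⟨m, rfl⟩ := Nat.exists_eq_add_of_le hjk
  have e4 : x ^ ((((2 * k + 2 + m : ℕ) : ℝ) - 1) / 2 - k) = s ^ (m + 1) := by
    rw [← hs2, ← Real.rpow_natCast s 2, ← Real.rpow_mul hs0.le, ← Real.rpow_natCast s (m + 1)]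
    congr 1; push_cast; ring
  have e5 : (x + b) ^ (((2 * k + 2 + m : ℕ) : ℝ) / 2 + k) = y ^ (4 * k + 2 + m) := by
    rw [← hy2, ← Real.rpow_natCast y 2, ← Real.rpow_mul hy0.le, ← Real.rpow_natCast y _]
    congr 1; push_cast; ring
  rw [e5, e4] at h
  set C := (((((2 * k + 2 + m : ℕ) : ℝ) - 2 * k - 1) / (4 * k + 1)) ^
    ((((2 * k + 2 + m : ℕ) : ℝ) - 1) / 2 - k) /
            ((((2 * k + 2 + m : ℕ) : ℝ) + 2 * k) / (4 * k + 1)) ^ (((2 * k + 2 + m : ℕ) : ℝ) / 2 + k))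
  set D := b ^ (-2 * (k : ℝ) - 3 / 2)
  have hys : 0 < y - s := by linarith
  have key : b / (y - s) ≤ √(b + 2) + √2 := by
    have : b / (y - s) = y + s := by
      rw [div_eq_iff hys.ne']; linear_combination hs2 - hy2
    rw [this, hs, hy]
    exact add_le_add (Real.sqrt_le_sqrt (by linarith)) (Real.sqrt_le_sqrt hx2)
  have e6 : (s / y) ^ (2 * k + 2 + m - 1) / (y * (y - s)) / (s * y) ^ (2 * k)
      = s ^ (m + 1) / y ^ (4 * k + 2 + m) / (y - s) := by
    rw [show 2 * k + 2 + m - 1 = 2 * k + (m + 1) by omega]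
    rw [show 4 * k + 2 + m = 2 * k + (2 * k + (m + 1)) + 1 by omega]
    rw [div_pow, mul_pow, pow_add s, pow_succ y, pow_add y (2 * k) (2 * k + (m + 1))]
    field_simp
  rw [e6]
  have hCD : 0 ≤ C * D := by
    have : 0 < C * (D * b) := lt_of_lt_of_le (by positivity) h
    rw [← mul_assoc] at this
    exact (pos_of_mul_pos_left this hb.le).le
  calc _ ≤ C * (D * b) / (y - s) := by gcongr
    _ = b / (y - s) * (C * D) := by ring
    _ ≤ (√(b + 2) + √2) * (C * D) := by gcongr
    _ = _ := by ring

theorem deriv_bound_max_interior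
    (τ : ℝ) (hτ0 : 0 < τ) (hτ1 : τ < 1) (a : ℝ) (ha : a = (1 + τ) / (1 - τ))
    (j k : ℕ) (hjk : 2 * k + 2 ≤ j)
    (hconstraint : a ≤ ((j : ℝ) + 6 * k + 1) / ((j : ℝ) - 2 * k - 1))
    (f : ℝ → ℝ) (hf : ∀ t : ℝ, f t = (1 + t) ^ (j - 1) / (τ * (1 - t) + 1 + t) ^ j) :
    ∀ t ∈ Set.Icc (-1 : ℝ) 1,
      |iteratedDeriv (2 * k) f t| ≤
        (2 * k).factorial * (Real.sqrt (a + 1) + Real.sqrt 2) *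
          ((((j : ℝ) - 2 * k - 1) / (4 * k + 1)) ^ (((j : ℝ) - 1) / 2 - k) /
            (((j : ℝ) + 2 * k) / (4 * k + 1)) ^ ((j : ℝ) / 2 + k)) *
          ((a + 1) / 2) ^ j * (a - 1) ^ (-2 * (k : ℝ) - 3 / 2) := by
  have h1τ : 0 < 1 - τ := by linarith
  have ha1 : 1 < a := by rw [ha, lt_div_iff₀ h1τ]; linarith
  have hτa : 1 - τ = 2 / (a + 1) := by rw [ha]; field_simp; ring
  set F : ℂ → ℂ := fun z => (1 + z) ^ (j - 1) / (τ * (1 - z) + 1 + z) ^ j with hFdef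
  have hden : ∀ z : ℂ, (τ * (1 - z) + 1 + z) = ((2 / (a + 1) : ℝ) : ℂ) * (z + a) := by
    intro z
    have h2 : 1 + τ = (2 / (a + 1)) * a := by rw [← hτa, ha]; field_simp
    have h3 : (τ : ℂ) = 1 - ((2 / (a + 1) : ℝ) : ℂ) := by rw [← hτa]; push_cast; ring
    have h4 : 1 + (τ : ℂ) = ((2 / (a + 1) : ℝ) : ℂ) * (a : ℂ) := by exact_mod_cast h2
    linear_combination h4 - z * h3
  have hc0 : (2 / (a + 1) : ℝ) ≠ 0 := by positivity
  set U : Set ℂ := {z | z ≠ -(a : ℂ)} with hUdef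
  have hU : IsOpen U := isOpen_ne
  have hdne : ∀ z ∈ U, (τ * (1 - z) + 1 + z) ^ j ≠ 0 := by
    intro z hz
    rw [hden]
    refine pow_ne_zero _ (mul_ne_zero (by exact_mod_cast hc0) ?_)
    intro h; exact hz (eq_neg_of_add_eq_zero_left h)
  have hF : DifferentiableOn ℂ F U := by
    intro z hz
    have h1 : DifferentiableAt ℂ (fun z : ℂ => (1 + z) ^ (j - 1)) z := by fun_prop
    have h2 : DifferentiableAt ℂ (fun z : ℂ => (τ * (1 - z) + 1 + z) ^ j) z := by fun_prop
    exact (h1.fun_div h2 (hdne z hz)).differentiableWithinAt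
  have hfF : ∀ t : ℝ, f t = (F t).re := by
    intro t
    have : F t = ((f t : ℝ) : ℂ) := by rw [hf, hFdef]; push_cast; rfl
    rw [this, Complex.ofReal_re]
  have hmemU : ∀ t : ℝ, -1 ≤ t → (t : ℂ) ∈ U := by
    intro t ht h
    have : t = -a := by exact_mod_cast h
    linarith
  have hreal := aux_real f F U hU hF hfF (2 * k)
  set R := (2 * k).factorial * (Real.sqrt (a + 1) + Real.sqrt 2) *
          ((((j : ℝ) - 2 * k - 1) / (4 * k + 1)) ^ (((j : ℝ) - 1) / 2 - k) /
            (((j : ℝ) + 2 * k) / (4 * k + 1)) ^ ((j : ℝ) / 2 + k)) *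
          ((a + 1) / 2) ^ j * (a - 1) ^ (-2 * (k : ℝ) - 3 / 2) with hR
  have main : ∀ t : ℝ, -1 < t → t ≤ 1 → ‖iteratedDeriv (2 * k) F t‖ ≤ R := by
    intro t ht1 ht2
    have hx : 0 < 1 + t := by linarith
    have hb : 0 < a - 1 := by linarith
    have hfin := aux_final (1 + t) (a - 1) j k hjk hx (by linarith) hb _ _ rfl rfl
    set s := √(1 + t) with hs
    set y := √(1 + t + (a - 1)) with hy
    have hs0 : 0 < s := by rw [hs]; positivity
    have hsy : s < y := by rw [hs, hy]; exact Real.sqrt_lt_sqrt hx.le (by linarith)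
    have hy0 : 0 < y := hs0.trans hsy
    have hys : 0 < y - s := by linarith
    have hs2 : s ^ 2 = 1 + t := by rw [hs]; exact Real.sq_sqrt hx.le
    have hy2 : y ^ 2 = 1 + t + (a - 1) := by rw [hy]; exact Real.sq_sqrt (by positivity)
    have hcl : Metric.closedBall (t : ℂ) (s * y) ⊆ U := by
      intro z hz h
      rw [Metric.mem_closedBall, dist_eq_norm, h] at hz
      have e : -(a : ℂ) - t = ((-(y ^ 2) : ℝ) : ℂ) := by rw [hy2]; push_cast; ring
      rw [e, Complex.norm_real, norm_neg, Real.norm_of_nonneg (by positivity)] at hz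
      nlinarith
    have hsph : ∀ z ∈ Metric.sphere (t : ℂ) (s * y),
        ‖F z‖ ≤ ((a + 1) / 2) ^ j * ((s / y) ^ (j - 1) / (y * (y - s))) := by
      intro z hz
      rw [mem_sphere_iff_norm] at hz
      obtain ⟨h1, h2⟩ := aux_sphere_s9 s y hs0 hsy (1 + z) (by
        rw [← hz, hs2]; congr 1; push_cast; ring)
      have e : (1 + z) + ((y ^ 2 - s ^ 2 : ℝ) : ℂ) = z + a := by
        rw [hy2, hs2]; push_cast; ring
      rw [e] at h1 h2
      have hN : 0 < ‖z + a‖ := lt_of_lt_of_le (by positivity) h2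
      have : ‖F z‖ = ((a + 1) / 2) ^ j * ((s / y) ^ (j - 1) / ‖z + a‖) := by
        simp only [hFdef]
        rw [hden, norm_div, norm_pow, norm_pow, norm_mul, h1, Complex.norm_real,
          Real.norm_of_nonneg (by positivity)]
        obtain ⟨m, rfl⟩ : ∃ m, j = m + 1 := ⟨j - 1, by omega⟩
        rw [Nat.add_sub_cancel, mul_pow, mul_pow, pow_succ ‖z + a‖, div_pow, div_pow, div_pow]
        field_simp
      rw [this]
      gcongr
    have hC := Complex.norm_iteratedDeriv_le_of_forall_mem_sphere_norm_le (2 * k)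
      (by positivity : 0 < s * y) (hF.diffContOnCl_ball hcl) hsph
    refine hC.trans ?_
    rw [show a - 1 + 2 = a + 1 by ring] at hfin
    calc _ = ((2 * k).factorial * ((a + 1) / 2) ^ j) *
          ((s / y) ^ (j - 1) / (y * (y - s)) / (s * y) ^ (2 * k)) := by ring
      _ ≤ _ := mul_le_mul_of_nonneg_left hfin (by positivity)
      _ = R := by rw [hR]; ring
  have main2 : ∀ t : ℝ, -1 < t → t ≤ 1 → |iteratedDeriv (2 * k) f t| ≤ R := by
    intro t h1 h2
    rw [hreal t (hmemU t h1.le)]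
    exact (Complex.abs_re_le_norm _).trans (main t h1 h2)
  intro t ht
  rcases ht.1.lt_or_eq with h | h
  · exact main2 t h ht.2
  · subst h
    rw [hreal _ (hmemU _ le_rfl)]
    refine (Complex.abs_re_le_norm _).trans ?_
    have hcont : ContinuousAt (fun t : ℝ => ‖iteratedDeriv (2 * k) F t‖) (-1) := by
      have h1 := ((hF.analyticOnNhd hU).iterated_deriv (2 * k) _ (hmemU (-1) le_rfl)).continuousAt
      rw [← iteratedDeriv_eq_iterate] at h1
      exact (ContinuousAt.comp (f := fun t : ℝ => (t : ℂ)) (x := -1) h1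
        Complex.continuous_ofReal.continuousAt).norm
    refine le_of_tendsto (hcont.tendsto.mono_left (nhdsWithin_le_nhds (s := Set.Ioi (-1 : ℝ)))) ?_
    filter_upwards [Ioc_mem_nhdsGT (show (-1 : ℝ) < 1 by norm_num)] with t ht
    exact main t ht.1 ht.2
end

section
/- Let 0 < τ < 1 and set a := (1+τ)/(1−τ). For a natural number j ≥ 1 define f_j : ℝ → ℝ by f_j(t) = (1+t)^{j−1}/(τ(1−t)+1+t)^j. If k and j are natural numbers with j ≥ 2k+2 and a > (j+6k+1)/(j−2k−1), then for every t ∈ [−1,1], |f_j^{(2k)}(t)| ≤ (2k)! · (√(a+1) + √2)/(a−1) · (a+1)^{j/2−k} / 2^{(j+1)/2+k}. -/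
theorem aux_iteratedDeriv_re (g : ℂ → ℂ) (U : Set ℂ) (hU : IsOpen U) (hg : DifferentiableOn ℂ g U)
    (f : ℝ → ℝ) (hfg : ∀ x : ℝ, f x = (g x).re) (n : ℕ) :
    DifferentiableOn ℂ (iteratedDeriv n g) U ∧
    ∀ x : ℝ, (x : ℂ) ∈ U → iteratedDeriv n f x = (iteratedDeriv n g x).re := by
  induction n with
  | zero => exact ⟨by simpa using hg, fun x _ => by simpa using hfg x⟩
  | succ n ih =>
    obtain ⟨h1, h2⟩ := ih
    refine ⟨?_, ?_⟩
    · rw [iteratedDeriv_succ]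
      exact h1.deriv hU
    · intro x hx
      rw [iteratedDeriv_succ, iteratedDeriv_succ]
      have h3 : HasDerivAt (iteratedDeriv n g) (deriv (iteratedDeriv n g) x) (x : ℂ) :=
        (h1.differentiableAt (hU.mem_nhds hx)).hasDerivAt
      have h4 := h3.real_of_complex
      have h5 : ∀ᶠ y : ℝ in nhds x, (y : ℂ) ∈ U :=
        Complex.continuous_ofReal.continuousAt.eventually (hU.mem_nhds hx)
      have h6 : iteratedDeriv n f =ᶠ[nhds x] fun y : ℝ => (iteratedDeriv n g y).re := by
        filter_upwards [h5] with y hy using h2 y hy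
      exact (h4.congr_of_eventuallyEq h6).deriv

theorem aux_max_s10 (p a : ℝ) (hp0 : 0 < p) (hp2 : p ≤ 2) (ha : 1 < a) (m N : ℕ) (hN : 0 < N)
    (hmN : m ≤ N) (h : 2 * (N : ℝ) ≤ m * (a + 1)) :
    (√p / √2) ^ m ≤ (√(p + (a - 1)) / √(a + 1)) ^ N := by
  have hN' : (0 : ℝ) < N := by exact_mod_cast hN
  have hmN' : (m : ℝ) ≤ N := by exact_mod_cast hmN
  have hb := rpow_one_add_le_one_add_mul_self (s := p / 2 - 1) (by linarith) (p := (m : ℝ) / N)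
    (by positivity) ((div_le_one hN').2 hmN')
  have e1 : 1 + (p / 2 - 1) = p / 2 := by ring
  rw [e1] at hb
  have h2 : 2 / (a + 1) ≤ (m : ℝ) / N := by
    rw [div_le_div_iff₀ (by linarith) hN']; exact h
  have h3 : (p / 2) ^ ((m : ℝ) / N) ≤ (p + (a - 1)) / (a + 1) := by
    refine hb.trans ?_
    have e : (p + (a - 1)) / (a + 1) = 1 + 2 / (a + 1) * (p / 2 - 1) := by
      have : a + 1 ≠ 0 := by linarith
      field_simp; ring
    rw [e]
    nlinarith
  have h4 : (p / 2) ^ m ≤ ((p + (a - 1)) / (a + 1)) ^ N := by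
    have := pow_le_pow_left₀ (by positivity) h3 N
    rwa [← Real.rpow_mul_natCast (by positivity), div_mul_cancel₀ _ hN'.ne', Real.rpow_natCast] at this
  rw [← Real.sqrt_div hp0.le, ← Real.sqrt_div (by linarith)]
  refine le_of_sq_le_sq ?_ (by positivity)
  rw [← pow_mul, ← pow_mul, mul_comm m, mul_comm N, pow_mul, pow_mul, Real.sq_sqrt (by positivity),
    Real.sq_sqrt (div_nonneg (by linarith) (by linarith))]
  exact h4

theorem aux_cauchy (g : ℂ → ℂ) (C a t : ℝ) (hC : 0 < C) (ha : 1 < a) (ht : -1 < t) (m k : ℕ)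
    (hg : ∀ z, g z = C * ((1 + z) ^ (m + 2 * k) / (a + z) ^ (m + 2 * k + 1)))
    (hd : DifferentiableOn ℂ g {z | -a < z.re}) :
    ‖iteratedDeriv (2 * k) g t‖ ≤ (2 * k).factorial * (C * ((√(a + t) + √(1 + t)) / (a - 1)) *
      (√(1 + t) ^ m / √(a + t) ^ (m + 4 * k + 1))) := by
  set P := √(1 + t) with hP
  set Q := √(a + t) with hQ
  have hP0 : 0 < P := Real.sqrt_pos.2 (by linarith)
  have hPQ : P < Q := Real.sqrt_lt_sqrt (by linarith) (by linarith)
  have hQ0 : 0 < Q := hP0.trans hPQ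
  have hP2 : P ^ 2 = 1 + t := Real.sq_sqrt (by linarith)
  have hQ2 : Q ^ 2 = a + t := Real.sq_sqrt (by linarith)
  have hr : 0 < P * Q := by positivity
  have hsub : Metric.closedBall (t : ℂ) (P * Q) ⊆ {z | -a < z.re} := by
    intro z hz
    rw [mem_closedBall_iff_norm] at hz
    have h1 := (abs_le.1 ((Complex.abs_re_le_norm _).trans hz)).1
    simp only [Complex.sub_re, Complex.ofReal_re] at h1
    simp only [Set.mem_ofPred_eq]
    nlinarith
  have hdc : DiffContOnCl ℂ g (Metric.ball (t : ℂ) (P * Q)) :=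
    (hd.mono hsub).diffContOnCl_ball subset_rfl
  have key : ∀ z ∈ Metric.sphere (t : ℂ) (P * Q),
      ‖g z‖ ≤ C * ((P / Q) ^ (m + 2 * k) / (Q * (Q - P))) := by
    intro z hz
    rw [mem_sphere_iff_norm] at hz
    have hsq : (z.re - t) ^ 2 + z.im ^ 2 = (P * Q) ^ 2 := by
      rw [← hz, Complex.sq_norm, Complex.normSq_apply]
      simp; ring
    have n1 : ‖1 + z‖ ^ 2 = P ^ 2 * (P ^ 2 + Q ^ 2 + 2 * (z.re - t)) := by
      rw [Complex.sq_norm, Complex.normSq_apply]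
      simp
      have : (1 + z.re) = P ^ 2 + (z.re - t) := by rw [hP2]; ring
      rw [this]; linarith
    have n2 : ‖(a : ℂ) + z‖ ^ 2 = Q ^ 2 * (P ^ 2 + Q ^ 2 + 2 * (z.re - t)) := by
      rw [Complex.sq_norm, Complex.normSq_apply]
      simp
      have : (a + z.re) = Q ^ 2 + (z.re - t) := by rw [hQ2]; ring
      rw [this]; linarith
    have n3 : ‖1 + z‖ = P / Q * ‖(a : ℂ) + z‖ := by
      rw [← sq_eq_sq₀ (norm_nonneg _) (by positivity), mul_pow, n1, n2]
      field_simp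
    have n4 : Q * (Q - P) ≤ ‖(a : ℂ) + z‖ := by
      have h1 : ‖(a + t : ℂ)‖ = Q ^ 2 := by
        rw [hQ2, ← Complex.ofReal_add, Complex.norm_real, Real.norm_of_nonneg (by linarith)]
      have h2 := norm_sub_le ((a : ℂ) + z) (z - t)
      have h3 : (a : ℂ) + z - (z - t) = a + t := by ring
      rw [h3, h1, hz] at h2
      linarith
    have hQP : 0 < Q * (Q - P) := mul_pos hQ0 (by linarith)
    have n5 : 0 < ‖(a : ℂ) + z‖ := hQP.trans_le n4
    rw [hg, norm_mul, norm_div, norm_pow, norm_pow, Complex.norm_real, Real.norm_of_nonneg hC.le, n3]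
    have : (P / Q * ‖(a : ℂ) + z‖) ^ (m + 2 * k) / ‖(a : ℂ) + z‖ ^ (m + 2 * k + 1)
        = (P / Q) ^ (m + 2 * k) / ‖(a : ℂ) + z‖ := by
      rw [mul_pow, pow_succ ‖(a : ℂ) + z‖]; field_simp
    rw [this]
    gcongr
  have := Complex.norm_iteratedDeriv_le_of_forall_mem_sphere_norm_le (2 * k) hr hdc key
  refine this.trans (le_of_eq ?_)
  have hne : Q - P ≠ 0 := by linarith
  have ea : a - 1 = (Q - P) * (Q + P) := by
    have : a - 1 = Q ^ 2 - P ^ 2 := by rw [hQ2, hP2]; ring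
    rw [this]; ring
  have hne2 : Q + P ≠ 0 := by linarith
  rw [ea, div_pow, mul_pow, pow_add P, pow_add Q m, show m + 4 * k + 1 = m + 2 * k + 2 * k + 1 by ring,
    pow_succ, pow_add Q (m + 2 * k), pow_add Q m]
  field_simp

theorem deriv_bound_max_endpoint
    (τ : ℝ) (hτ0 : 0 < τ) (hτ1 : τ < 1) (a : ℝ) (ha : a = (1 + τ) / (1 - τ))
    (j k : ℕ) (hjk : 2 * k + 2 ≤ j)
    (hconstraint : ((j : ℝ) + 6 * k + 1) / ((j : ℝ) - 2 * k - 1) < a)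
    (f : ℝ → ℝ) (hf : ∀ t : ℝ, f t = (1 + t) ^ (j - 1) / (τ * (1 - t) + 1 + t) ^ j) :
    ∀ t ∈ Set.Icc (-1 : ℝ) 1,
      |iteratedDeriv (2 * k) f t| ≤
        (2 * k).factorial * ((Real.sqrt (a + 1) + Real.sqrt 2) / (a - 1)) *
          ((a + 1) ^ ((j : ℝ) / 2 - k) / 2 ^ (((j : ℝ) + 1) / 2 + k)) := by
  obtain ⟨m, rfl⟩ : ∃ m, j = m + 2 * k + 1 := ⟨j - 2 * k - 1, by omega⟩
  have hm : 1 ≤ m := by omega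
  have hm' : (1 : ℝ) ≤ m := by exact_mod_cast hm
  have h1τ : 0 < 1 - τ := by linarith
  have ha1 : 1 < a := by rw [ha, lt_div_iff₀ h1τ]; linarith
  have hτa : 1 - τ = 2 / (a + 1) := by rw [ha]; field_simp; ring
  have hcon : 2 * ((m + 4 * k + 1 : ℕ) : ℝ) ≤ m * (a + 1) := by
    push_cast at hconstraint ⊢
    rw [div_lt_iff₀ (by linarith)] at hconstraint
    nlinarith
  set C : ℝ := ((a + 1) / 2) ^ (m + 2 * k + 1) with hCdef
  have hC : 0 < C := by positivity
  set g : ℂ → ℂ := fun z => C * ((1 + z) ^ (m + 2 * k) / (a + z) ^ (m + 2 * k + 1)) with hgdef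
  have hU : IsOpen {z : ℂ | -a < z.re} := isOpen_lt continuous_const Complex.continuous_re
  have hd : DifferentiableOn ℂ g {z | -a < z.re} := by
    intro z hz
    have hne : (a : ℂ) + z ≠ 0 := by
      intro h
      have := congrArg Complex.re h
      simp at this hz
      linarith
    have hne2 : ((a : ℂ) + z) ^ (m + 2 * k + 1) ≠ 0 := pow_ne_zero _ hne
    apply DifferentiableAt.differentiableWithinAt
    have h1 : DifferentiableAt ℂ (fun z : ℂ => (1 + z) ^ (m + 2 * k)) z := by fun_prop
    have h2 : DifferentiableAt ℂ (fun z : ℂ => ((a : ℂ) + z) ^ (m + 2 * k + 1)) z := by fun_prop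
    exact (h1.fun_div h2 hne2).const_mul _
  have hfg : ∀ x : ℝ, f x = (g x).re := by
    intro x
    have e1 : g x = ((C * ((1 + x) ^ (m + 2 * k) / (a + x) ^ (m + 2 * k + 1)) : ℝ) : ℂ) := by
      simp [hgdef]
    have e2 : τ * (1 - x) + 1 + x = (2 / (a + 1)) * (a + x) := by
      have e3 : τ = 1 - 2 / (a + 1) := by linarith
      have : a + 1 ≠ 0 := by linarith
      rw [e3]; field_simp; ring
    rw [e1, Complex.ofReal_re, hf, e2, hCdef, Nat.add_sub_cancel, mul_pow, div_pow, div_pow]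
    have : a + 1 ≠ 0 := by linarith
    field_simp
  obtain ⟨hdn, hre⟩ := aux_iteratedDeriv_re g _ hU hd f hfg (2 * k)
  have hA : (a + 1) ^ (((m + 2 * k + 1 : ℕ) : ℝ) / 2 - k) = √(a + 1) ^ (m + 1) := by
    rw [← Real.rpow_natCast, ← Real.rpow_div_two_eq_sqrt _ (by linarith)]
    congr 1; push_cast; ring
  have hS : (2 : ℝ) ^ ((((m + 2 * k + 1 : ℕ) : ℝ) + 1) / 2 + k) = √2 ^ (m + 4 * k + 2) := by
    rw [← Real.rpow_natCast, ← Real.rpow_div_two_eq_sqrt _ (by norm_num)]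
    congr 1; push_cast; ring
  rw [hA, hS]
  have hmain : ∀ t ∈ Set.Ioc (-1 : ℝ) 1, |iteratedDeriv (2 * k) f t| ≤
        (2 * k).factorial * ((√(a + 1) + √2) / (a - 1)) *
          (√(a + 1) ^ (m + 1) / √2 ^ (m + 4 * k + 2)) := by
    rintro t ⟨ht0, ht1⟩
    rw [hre t (by simp; linarith)]
    refine (Complex.abs_re_le_norm _).trans ?_
    refine (aux_cauchy g C a t hC ha1 ht0 m k (fun z => rfl) hd).trans ?_
    have hmx := aux_max_s10 (1 + t) a (by linarith) (by linarith) ha1 m (m + 4 * k + 1) (by omega)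
      (by omega) hcon
    rw [show 1 + t + (a - 1) = a + t by ring, div_pow, div_pow] at hmx
    have s2 : 0 < √(2 : ℝ) := by positivity
    have sA : 0 < √(a + 1) := Real.sqrt_pos.2 (by linarith)
    have sQ : 0 < √(a + t) := Real.sqrt_pos.2 (by linarith)
    have hmx2 : √(1 + t) ^ m / √(a + t) ^ (m + 4 * k + 1) ≤
        √2 ^ m / √(a + 1) ^ (m + 4 * k + 1) := by
      rw [div_le_div_iff₀ (by positivity) (by positivity)] at hmx ⊢
      linarith
    have hCe : C * (√2 ^ m / √(a + 1) ^ (m + 4 * k + 1)) =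
        √(a + 1) ^ (m + 1) / √2 ^ (m + 4 * k + 2) := by
      have e1 : a + 1 = √(a + 1) ^ 2 := (Real.sq_sqrt (by linarith)).symm
      have e2 : (2 : ℝ) = √2 ^ 2 := (Real.sq_sqrt (by norm_num)).symm
      have e3 : C = √(a + 1) ^ (2 * (m + 2 * k + 1)) / √2 ^ (2 * (m + 2 * k + 1)) := by
        rw [pow_mul, pow_mul, ← e1, ← e2, hCdef, div_pow]
      rw [e3, div_mul_div_comm, div_eq_div_iff (by positivity) (by positivity)]
      ring
    have ha1' : 0 < a - 1 := by linarith
    calc _ ≤ ((2 * k).factorial : ℝ) * (C * ((√(a + 1) + √2) / (a - 1)) *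
          (√2 ^ m / √(a + 1) ^ (m + 4 * k + 1))) := by
          gcongr
          linarith
      _ = (2 * k).factorial * ((√(a + 1) + √2) / (a - 1)) *
          (C * (√2 ^ m / √(a + 1) ^ (m + 4 * k + 1))) := by ring
      _ = _ := by rw [hCe]
  intro t ht
  have hcl : closure (Set.Ioc (-1 : ℝ) 1) = Set.Icc (-1) 1 := closure_Ioc (by norm_num)
  have hcont : ContinuousOn (iteratedDeriv (2 * k) f) (Set.Icc (-1 : ℝ) 1) := by
    have h1 : ContinuousOn (fun x : ℝ => (iteratedDeriv (2 * k) g x).re) (Set.Icc (-1 : ℝ) 1) := by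
      refine Complex.continuous_re.comp_continuousOn
        (hdn.continuousOn.comp Complex.continuous_ofReal.continuousOn ?_)
      intro x hx
      simp only [Set.mem_ofPred_eq, Complex.ofReal_re]
      linarith [hx.1]
    refine h1.congr fun x hx => hre x ?_
    simp only [Set.mem_ofPred_eq, Complex.ofReal_re]
    linarith [hx.1]
  rw [← hcl] at ht hcont
  exact le_on_closure hmain hcont.abs continuousOn_const ht
end

section
/- Let k ≥ 1 and j be natural numbers with j ≥ 2k+3, and define h : (1,∞) → ℝ by h(a) = (a+1)^j · (a−1)^{−2k−3/2} (real powers). Then h attains its minimum over (1,∞) at a^{(1)} := (2j+4k+3)/(2j−4k−3); that is, a^{(1)} > 1 and h(a^{(1)}) ≤ h(a) for every a > 1. -/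
theorem min_of_bound_factor
    (k j : ℕ) (hk : 1 ≤ k) (hj : 2 * k + 3 ≤ j)
    (h : ℝ → ℝ)
    (hh : ∀ a : ℝ, h a = (a + 1) ^ j * (a - 1) ^ (-2 * (k : ℝ) - 3 / 2))
    (a1 : ℝ) (ha1 : a1 = (2 * (j : ℝ) + 4 * k + 3) / (2 * (j : ℝ) - 4 * k - 3)) :
    1 < a1 ∧ ∀ a : ℝ, 1 < a → h a1 ≤ h a := by
  have hj' : 2 * (k : ℝ) + 3 ≤ j := by exact_mod_cast hj
  have hk' : (1 : ℝ) ≤ k := by exact_mod_cast hk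
  obtain ⟨p, hp⟩ : ∃ p : ℝ, p = 2 * k + 3 / 2 := ⟨_, rfl⟩
  have hp0 : 0 < p := by linarith
  have hpj : 0 < (j : ℝ) - p := by linarith
  have hj0 : (0 : ℝ) < j := by linarith
  have e : a1 = (j + p) / (j - p) := by
    rw [ha1, div_eq_div_iff (by linarith) hpj.ne', hp]; ring
  have hA : a1 + 1 = 2 * j / (j - p) := by rw [e]; field_simp; ring
  have hB : a1 - 1 = 2 * p / (j - p) := by rw [e]; field_simp; ring
  have hB0 : 0 < a1 - 1 := by rw [hB]; positivity
  have hA0 : 0 < a1 + 1 := by linarith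
  refine ⟨by linarith, fun a ha => ?_⟩
  obtain ⟨v, hv⟩ : ∃ v, v = (a - 1) / (a1 - 1) := ⟨_, rfl⟩
  obtain ⟨u, hu⟩ : ∃ u, u = (a + 1) / (a1 + 1) := ⟨_, rfl⟩
  have hv0 : 0 < v := by rw [hv]; exact div_pos (by linarith) hB0
  have hav : a - 1 = v * (a1 - 1) := by rw [hv]; field_simp
  have hau : a + 1 = u * (a1 + 1) := by rw [hu]; field_simp
  have huv : u = p / j * v + (1 - p / j) * 1 := by
    rw [hu, hv, hA, hB]; field_simp; ring
  have key : v ^ (p / j) ≤ u := by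
    have := Real.geom_mean_le_arith_mean2_weighted (w₁ := p / j) (w₂ := 1 - p / j)
      (p₁ := v) (p₂ := 1) (by positivity)
      (by rw [sub_nonneg, div_le_one hj0]; linarith) hv0.le zero_le_one (by ring)
    rw [Real.one_rpow, mul_one, ← huv] at this
    exact this
  have key2 : v ^ p ≤ u ^ j := by
    have := pow_le_pow_left₀ (Real.rpow_nonneg hv0.le _) key j
    rwa [← Real.rpow_natCast, ← Real.rpow_mul hv0.le, div_mul_cancel₀ _ hj0.ne'] at this
  have hexp : -2 * (k : ℝ) - 3 / 2 = -p := by rw [hp]; ring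
  rw [hh, hh, hexp, hav, hau, mul_pow, Real.mul_rpow hv0.le hB0.le, Real.rpow_neg hv0.le]
  have hvp : 0 < v ^ p := Real.rpow_pos_of_pos hv0 p
  have h1 : 1 ≤ u ^ j * (v ^ p)⁻¹ := by
    rw [← div_eq_mul_inv, one_le_div hvp]; exact key2
  have hP : 0 ≤ (a1 + 1) ^ j * (a1 - 1) ^ (-p) :=
    mul_nonneg (pow_nonneg hA0.le _) (Real.rpow_nonneg hB0.le _)
  calc (a1 + 1) ^ j * (a1 - 1) ^ (-p)
      ≤ (u ^ j * (v ^ p)⁻¹) * ((a1 + 1) ^ j * (a1 - 1) ^ (-p)) := le_mul_of_one_le_left hP h1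
    _ = _ := by ring
end
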